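/- Let K be a field, E a finite set, M a matroid on E of rank at least 1, and W ⊆ K^E a realization of M. Then M is connected if and only if M has no loops and the configuration polynomial ψ_W is irreducible in K[x_e : e ∈ E]. In particular, if M = ⊕_{i=1}^n M_i decomposes into its connected components with induced decomposition W = ⊕_{i=1}^n W_i, then ψ_W = Π_{i=1}^n ψ_{W_i} (for compatible basis choices), where ψ_{W_i} is irreducible when rk M_i ≥ 1 and ψ_{W_i} = 1 otherwise. -/

import Mathlib

open scoped BigOperators

namespace Config

variable {K : Type} [Field K] {E : Type} [Fintype E] [DecidableEq E]

/-- The coordinate functional `e^∨` of `K^E` restricted to a subspace `W ⊆ K^E`. -/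
noncomputable def coordFun (W : Submodule K (E → K)) (e : E) : W →ₗ[K] K :=
  (LinearMap.proj e).comp W.subtype

/-- `S ⊆ E` is independent in the matroid `M_W` realized by the configuration `W`:
the restricted coordinate functionals `(e^∨|_W)_{e ∈ S}` are linearly independent. -/
def Indep (W : Submodule K (E → K)) (S : Finset E) : Prop :=
  LinearIndependent K (fun e : S => coordFun W e)

/-- A circuit of the matroid `M_W`: a minimal dependent subset of `E`. -/
def IsCircuit (W : Submodule K (E → K)) (C : Finset E) : Prop :=
  ¬ Indep W C ∧ ∀ D ⊂ C, Indep W D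

/-- The matroid `M_W` is connected: the ground set is nonempty and any two distinct
elements lie on a common circuit. -/
def Connected (W : Submodule K (E → K)) : Prop :=
  Nonempty E ∧ ∀ e f : E, e ≠ f → ∃ C : Finset E, IsCircuit W C ∧ e ∈ C ∧ f ∈ C

/-- The restriction `M_W|_F` is connected: `F` is nonempty and any two distinct
elements of `F` lie on a common circuit of `M_W` contained in `F`. -/
def ConnectedOn (W : Submodule K (E → K)) (F : Finset E) : Prop :=
  F.Nonempty ∧ ∀ e ∈ F, ∀ f ∈ F, e ≠ f →
    ∃ C : Finset E, IsCircuit W C ∧ C ⊆ F ∧ e ∈ C ∧ f ∈ C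

/-- `w` is a (linear) basis of the configuration `W ⊆ K^E`. -/
def IsBasisOf {r : ℕ} (w : Fin r → E → K) (W : Submodule K (E → K)) : Prop :=
  LinearIndependent K w ∧ Submodule.span K (Set.range w) = W

/-- The configuration (bilinear) form `Q_W` computed from the basis `w`: the symmetric
`r × r` matrix with entries `∑_{e ∈ E} x_e · w^i_e · w^j_e` over `K[x_e : e ∈ E]`. -/
noncomputable def Qform {r : ℕ} (w : Fin r → E → K) :
    Matrix (Fin r) (Fin r) (MvPolynomial E K) :=
  Matrix.of fun i j => ∑ e : E, MvPolynomial.C (w i e * w j e) * MvPolynomial.X e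

/-- The coefficient `c_{W,B} = (det (w^i_e)_{1≤i≤r, e∈B})²`, the squared determinant of
the `r × r` submatrix of the coefficient matrix of `w` with column set `B` (the square
is independent of the chosen ordering of the columns). -/
noncomputable def cSq {r : ℕ} (w : Fin r → E → K) (B : Finset E) : K :=
  if h : B.card = r then
    (Matrix.det (Matrix.of fun i j : Fin r =>
      w i ((Finset.equivFinOfCardEq h).symm j : E))) ^ 2
  else 0

/-- The configuration polynomial `ψ_W = ∑_B c_{W,B} · x^B` computed from the basis `w`
(the coefficient `c_{W,B}` vanishes unless `B` is a basis of the matroid `M_W`). -/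
noncomputable def psi {r : ℕ} (w : Fin r → E → K) : MvPolynomial E K :=
  ∑ B ∈ Finset.univ.powersetCard r,
    MvPolynomial.C (cSq w B) * ∏ e ∈ B, MvPolynomial.X e

/-- The subspace of vectors of `K^E` supported on the subset `F`. -/
noncomputable def suppOn (F : Finset E) : Submodule K (E → K) :=
  LinearMap.ker (LinearMap.funLeft K K (fun e : {x : E // x ∉ F} => (e : E)))

/-- Cauchy–Binet for the configuration form. -/
theorem psi_eq_det {r : ℕ} (w : Fin r → E → K) : psi w = (Qform w).det := by
  classical
  let A : E → Fin r → MvPolynomial E K := fun e i => MvPolynomial.C (w i e)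
  have h1 : (Qform w).det = ∑ p : Fin r → E,
      (∏ i, (MvPolynomial.X (p i) * MvPolynomial.C (w i (p i)) : MvPolynomial E K)) *
        Matrix.det (Matrix.of fun i => A (p i)) := by
    have h2 : Qform w = Matrix.of (fun i => ∑ e : E,
        (MvPolynomial.X e * MvPolynomial.C (w i e) : MvPolynomial E K) • A e) := by
      ext1 i j
      simp only [Qform, Matrix.of_apply, Finset.sum_apply, Pi.smul_apply, smul_eq_mul, A]
      refine Finset.sum_congr rfl fun e _ => ?_
      rw [MvPolynomial.C_mul]; ring
    rw [h2]
    have h3 := (Matrix.detRowAlternating (n := Fin r) (R := MvPolynomial E K)).toMultilinearMap.map_sum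
      (fun i (e : E) => (MvPolynomial.X e * MvPolynomial.C (w i e) : MvPolynomial E K) • A e)
    refine Eq.trans h3 (Finset.sum_congr rfl fun p _ => ?_)
    have := (Matrix.detRowAlternating (n := Fin r) (R := MvPolynomial E K)).toMultilinearMap.map_smul_univ
      (fun i => (MvPolynomial.X (p i) * MvPolynomial.C (w i (p i)) : MvPolynomial E K)) (fun i => A (p i))
    exact this
  rw [h1]
  have hzero : ∀ p : Fin r → E, ¬ Function.Injective p →
      Matrix.det (Matrix.of fun i => A (p i)) = 0 := by
    intro p hp
    simp only [Function.Injective, not_forall] at hp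
    obtain ⟨a, b, hab, hne⟩ := hp
    exact Matrix.det_zero_of_row_eq hne (by change A (p a) = A (p b); rw [hab])
  rw [← Finset.sum_filter_of_ne (p := fun p => Function.Injective p)
    (fun p _ h => by by_contra hp; exact h (by rw [hzero p hp, mul_zero]))]
  have hmaps : ∀ p ∈ Finset.univ.filter (fun p : Fin r → E => Function.Injective p),
      Finset.univ.image p ∈ (Finset.univ : Finset E).powersetCard r := by
    intro p hp
    simp only [Finset.mem_filter, Finset.mem_univ, true_and] at hp
    simp [Finset.mem_powersetCard, Finset.card_image_of_injective _ hp]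
  rw [← Finset.sum_fiberwise_of_maps_to hmaps, psi]
  refine Finset.sum_congr rfl fun B hB => ?_
  have hc : B.card = r := (Finset.mem_powersetCard.1 hB).2
  let e0 : Fin r ≃ B := (Finset.equivFinOfCardEq hc).symm
  have h4 : ∑ p ∈ (Finset.univ.filter (fun p : Fin r → E => Function.Injective p)).filter
        (fun p => Finset.univ.image p = B),
      (∏ i, (MvPolynomial.X (p i) * MvPolynomial.C (w i (p i)) : MvPolynomial E K)) *
        Matrix.det (Matrix.of fun i => A (p i)) =
      ∑ σ : Equiv.Perm (Fin r),
        (∏ i, (MvPolynomial.X (e0 (σ i) : E) *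
            MvPolynomial.C (w i (e0 (σ i))) : MvPolynomial E K)) *
        Matrix.det (Matrix.of fun i => A (e0 (σ i))) := by
    symm
    refine Finset.sum_bij (fun σ _ => fun i => (e0 (σ i) : E)) ?_ ?_ ?_ ?_
    · intro σ _
      simp only [Finset.mem_filter, Finset.mem_univ, true_and]
      refine ⟨fun a b h => σ.injective (e0.injective (Subtype.ext h)), ?_⟩
      ext x
      simp only [Finset.mem_image, Finset.mem_univ, true_and]
      constructor
      · rintro ⟨i, rfl⟩; exact (e0 (σ i)).2
      · intro hx
        exact ⟨σ.symm (e0.symm ⟨x, hx⟩), by simp⟩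
    · intro σ _ τ _ h
      ext1 i
      exact e0.injective (Subtype.ext (congrFun h i))
    · intro p hp
      simp only [Finset.mem_filter, Finset.mem_univ, true_and] at hp
      obtain ⟨hpi, hpB⟩ := hp
      have hmem : ∀ i, p i ∈ B := fun i => hpB ▸ Finset.mem_image_of_mem p (Finset.mem_univ i)
      let f : Fin r → Fin r := fun i => e0.symm ⟨p i, hmem i⟩
      have hf : Function.Injective f := fun a b h => by
        have := e0.symm.injective h
        exact hpi (congrArg Subtype.val this)
      refine ⟨Equiv.ofBijective f (Finite.injective_iff_bijective.1 hf), Finset.mem_univ _, ?_⟩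
      funext i
      simp [f]
    · intro σ _; rfl
  rw [h4]
  have h5 : ∀ σ : Equiv.Perm (Fin r), Matrix.det (Matrix.of fun i => A (e0 (σ i))) =
      ((Equiv.Perm.sign σ : ℤ) : MvPolynomial E K) * Matrix.det (Matrix.of fun i => A (e0 i)) := by
    intro σ
    exact Matrix.det_permute σ (Matrix.of fun i => A (e0 i))
  have h6 : ∏ e ∈ B, (MvPolynomial.X e : MvPolynomial E K) = ∏ i, MvPolynomial.X (e0 i : E) := by
    rw [← Finset.prod_coe_sort B]
    exact (Equiv.prod_comp e0 (fun b : B => (MvPolynomial.X (b : E) : MvPolynomial E K))).symm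
  have h7 : ∀ σ : Equiv.Perm (Fin r),
      (∏ i, (MvPolynomial.X (e0 (σ i) : E) * MvPolynomial.C (w i (e0 (σ i))) : MvPolynomial E K)) =
        (∏ e ∈ B, MvPolynomial.X e) * ∏ i, MvPolynomial.C (w i (e0 (σ i))) := by
    intro σ
    rw [Finset.prod_mul_distrib, h6]
    congr 1
    exact Equiv.prod_comp σ (fun i => (MvPolynomial.X (e0 i : E) : MvPolynomial E K))
  have h8 : Matrix.det (Matrix.of fun i => A (e0 i)) =
      MvPolynomial.C (Matrix.det (Matrix.of fun i j : Fin r => w i (e0 j : E))) := by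
    rw [← Matrix.det_transpose, RingHom.map_det]
    rfl
  have h9 : ∑ σ : Equiv.Perm (Fin r), ((Equiv.Perm.sign σ : ℤ) : MvPolynomial E K) *
      ∏ i, MvPolynomial.C (w i (e0 (σ i))) = Matrix.det (Matrix.of fun i => A (e0 i)) := by
    rw [Matrix.det_apply']
    rfl
  have h10 : cSq w B = (Matrix.det (Matrix.of fun i j : Fin r => w i (e0 j : E))) ^ 2 := by
    rw [cSq, dif_pos hc]
  calc _ = (∏ e ∈ B, MvPolynomial.X e) * Matrix.det (Matrix.of fun i => A (e0 i)) *
        (∑ σ : Equiv.Perm (Fin r), ((Equiv.Perm.sign σ : ℤ) : MvPolynomial E K) *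
      ∏ i, MvPolynomial.C (w i (e0 (σ i)))) := by
        rw [h9, h8, h10, MvPolynomial.C_pow]; ring
    _ = _ := by
        rw [Finset.mul_sum]
        refine Finset.sum_congr rfl fun σ _ => ?_
        rw [h7, h5]; ring

/-- Relations among the coordinate functionals. -/
def rel (W : Submodule K (E → K)) : Submodule K (E → K) where
  carrier := {u | ∀ v ∈ W, u ⬝ᵥ v = 0}
  add_mem' := by
    intro a b ha hb v hv
    rw [add_dotProduct, ha v hv, hb v hv, add_zero]
  zero_mem' := by intro v _; simp
  smul_mem' := by
    intro c a ha v hv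
    rw [smul_dotProduct, ha v hv, smul_zero]

theorem mem_rel {W : Submodule K (E → K)} {u : E → K} :
    u ∈ rel W ↔ ∀ v ∈ W, u ⬝ᵥ v = 0 := Iff.rfl

open Classical in
/-- Support of a vector. -/
noncomputable def supp (u : E → K) : Finset E := Finset.univ.filter fun e => u e ≠ 0

theorem mem_supp {u : E → K} {e : E} : e ∈ supp u ↔ u e ≠ 0 := by
  simp [supp]

theorem indep_iff {W : Submodule K (E → K)} {S : Finset E} :
    Indep W S ↔ ∀ u ∈ rel W, (∀ e, e ∉ S → u e = 0) → u = 0 := by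
  rw [Indep, Fintype.linearIndependent_iff]
  constructor
  · intro h u hu hS
    have := h (fun e => u e) (by
      ext v
      have h1 := hu v v.2
      rw [dotProduct, ← Finset.sum_subset (Finset.subset_univ S)
        (fun e _ he => by rw [hS e he, zero_mul]), ← Finset.sum_coe_sort S] at h1
      simpa [coordFun] using h1)
    funext e
    by_cases he : e ∈ S
    · exact this ⟨e, he⟩
    · exact hS e he
  · intro h g hg e
    let u : E → K := fun e => if he : e ∈ S then g ⟨e, he⟩ else 0
    have hu : u = 0 := h u (by
      intro v hv
      have h1 := LinearMap.congr_fun hg ⟨v, hv⟩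
      rw [dotProduct, ← Finset.sum_subset (Finset.subset_univ S)
        (fun e _ he => by simp [u, he]), ← Finset.sum_coe_sort S]
      simpa [coordFun, u] using h1) (fun e he => by simp [u, he])
    have := congrFun hu e
    simpa [u] using this

theorem circuit_vec {W : Submodule K (E → K)} {C : Finset E} (hC : IsCircuit W C) :
    ∃ u ∈ rel W, supp u = C := by
  obtain ⟨h1, h2⟩ := hC
  rw [indep_iff] at h1
  push Not at h1
  obtain ⟨u, hu, hS, hne⟩ := h1
  refine ⟨u, hu, ?_⟩
  have hsub : supp u ⊆ C := fun e he => by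
    by_contra h; exact mem_supp.1 he (hS e h)
  by_contra hn
  exact hne (indep_iff.1 (h2 _ (Finset.ssubset_iff_subset_ne.2 ⟨hsub, hn⟩)) u hu
    (fun e he => by by_contra h; exact he (mem_supp.2 h)))

theorem circuit_min {W : Submodule K (E → K)} {C : Finset E} (hC : IsCircuit W C)
    {u : E → K} (hu : u ∈ rel W) (hs : supp u ⊆ C) (hne : u ≠ 0) : supp u = C := by
  by_contra hn
  exact hne (indep_iff.1 (hC.2 _ (Finset.ssubset_iff_subset_ne.2 ⟨hs, hn⟩)) u hu
    (fun e he => by by_contra h; exact he (mem_supp.2 h)))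

/-- A nonzero relation either has circuit support or splits off one of smaller support. -/
theorem circuit_or {W : Submodule K (E → K)} {u : E → K} (hu : u ∈ rel W) (hne : u ≠ 0) :
    IsCircuit W (supp u) ∨ ∃ y ∈ rel W, y ≠ 0 ∧ supp y ⊂ supp u := by
  by_cases h : IsCircuit W (supp u)
  · exact Or.inl h
  · right
    have hd : ¬ Indep W (supp u) := fun hi => hne (indep_iff.1 hi u hu
      (fun e he => by by_contra h; exact he (mem_supp.2 h)))
    rw [IsCircuit, not_and] at h
    have := h hd
    push Not at this
    obtain ⟨D, hD, hDi⟩ := this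
    rw [indep_iff] at hDi
    push Not at hDi
    obtain ⟨y, hy, hS, hy0⟩ := hDi
    exact ⟨y, hy, hy0, lt_of_le_of_lt (fun e he => by
      by_contra h; exact mem_supp.1 he (hS e h)) hD⟩

theorem supp_elim {u y : E → K} (hs : supp y ⊂ supp u) {k : E} (hk : k ∈ supp y) :
    supp (u - (u k / y k) • y) ⊂ supp u := by
  rw [Finset.ssubset_iff_of_subset]
  · refine ⟨k, hs.1 hk, ?_⟩
    have := mem_supp.1 hk
    simp [mem_supp, this]
  · intro e he
    rw [mem_supp] at he ⊢
    intro h0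
    have : y e = 0 := by
      by_contra h; exact mem_supp.1 (hs.1 (mem_supp.2 h)) h0
    exact he (by simp [h0, this])

theorem exists_mem_supp {u : E → K} (h : u ≠ 0) : ∃ k, k ∈ supp u := by
  by_contra hn
  push Not at hn
  exact h (funext fun e => by by_contra h; exact hn e (mem_supp.2 h))

/-- Every element of the support of a relation lies on a circuit within the support. -/
theorem exists_circuit {W : Submodule K (E → K)} :
    ∀ (n : ℕ) (u : E → K), (supp u).card = n → u ∈ rel W → ∀ e ∈ supp u,
      ∃ C, IsCircuit W C ∧ C ⊆ supp u ∧ e ∈ C := by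
  intro n
  induction n using Nat.strong_induction_on with
  | _ n ih =>
  intro u hn hu e he
  have hne : u ≠ 0 := fun h => mem_supp.1 he (by simp [h])
  rcases circuit_or hu hne with h | ⟨y, hy, hy0, hs⟩
  · exact ⟨_, h, subset_rfl, he⟩
  · by_cases hey : e ∈ supp y
    · obtain ⟨C, h1, h2, h3⟩ := ih _ (hn ▸ Finset.card_lt_card hs) y rfl hy e hey
      exact ⟨C, h1, h2.trans hs.1, h3⟩
    · obtain ⟨k, hk⟩ := exists_mem_supp hy0
      have hlt := supp_elim hs hk
      have hmem : e ∈ supp (u - (u k / y k) • y) := by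
        rw [mem_supp] at he hey ⊢
        push Not at hey
        simpa [hey] using he
      obtain ⟨C, h1, h2, h3⟩ := ih _ (hn ▸ Finset.card_lt_card hlt) _ rfl
        ((rel W).sub_mem hu ((rel W).smul_mem _ hy)) e hmem
      exact ⟨C, h1, h2.trans hlt.1, h3⟩

theorem strong_elim {W : Submodule K (E → K)} {C₁ C₂ : Finset E} (h1 : IsCircuit W C₁)
    (h2 : IsCircuit W C₂) {g e : E} (hg1 : g ∈ C₁) (hg2 : g ∈ C₂) (he1 : e ∈ C₁)
    (he2 : e ∉ C₂) : ∃ C, IsCircuit W C ∧ C ⊆ C₁ ∪ C₂ ∧ g ∉ C ∧ e ∈ C := by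
  obtain ⟨u, hu, rfl⟩ := circuit_vec h1
  obtain ⟨v, hv, rfl⟩ := circuit_vec h2
  have hvg := mem_supp.1 hg2
  have hve : v e = 0 := by by_contra h; exact he2 (mem_supp.2 h)
  obtain ⟨C, c1, c2, c3⟩ := exists_circuit _ (u - (u g / v g) • v) rfl
    ((rel W).sub_mem hu ((rel W).smul_mem _ hv)) e (by
      rw [mem_supp] at *; simpa [hve] using he1)
  refine ⟨C, c1, fun x hx => ?_, fun hx => ?_, c3⟩
  · have := mem_supp.1 (c2 hx)
    rw [Finset.mem_union, mem_supp, mem_supp]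
    by_contra hn
    push Not at hn
    exact this (by simp [hn.1, hn.2])
  · have := mem_supp.1 (c2 hx)
    exact this (by simp [hvg])

theorem circuit_not_ssub {W : Submodule K (E → K)} {C D : Finset E} (hC : IsCircuit W C)
    (hD : IsCircuit W D) (h : D ⊆ C) : D = C := by
  by_contra hn
  exact hD.1 (hC.2 D (Finset.ssubset_iff_subset_ne.2 ⟨h, hn⟩))

theorem circuit_trans {W : Submodule K (E → K)} {e h : E} :
    ∀ (n : ℕ) (C₁ C₂ : Finset E), (C₁ ∪ C₂).card = n → IsCircuit W C₁ → IsCircuit W C₂ →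
      e ∈ C₁ → h ∈ C₂ → (C₁ ∩ C₂).Nonempty → ∃ C, IsCircuit W C ∧ e ∈ C ∧ h ∈ C := by
  intro n
  induction n using Nat.strong_induction_on with
  | _ n ih =>
  intro C₁ C₂ hn h1 h2 he hh ⟨g, hg⟩
  by_contra hno
  push Not at hno
  rw [Finset.mem_inter] at hg
  have he2 : e ∉ C₂ := fun hx => hno C₂ h2 hx hh
  obtain ⟨C₃, c3, s3, g3, e3⟩ := strong_elim h1 h2 hg.1 hg.2 he he2
  have hh3 := hno C₃ c3 e3
  obtain ⟨g', hg'3, hg'1⟩ : ∃ g' ∈ C₃, g' ∉ C₁ := by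
    by_contra hx
    push Not at hx
    have := circuit_not_ssub h1 c3 hx
    exact g3 (this ▸ hg.1)
  have hg'2 : g' ∈ C₂ := by
    have := s3 hg'3
    rw [Finset.mem_union] at this
    tauto
  have hun : C₃ ∪ C₂ = C₁ ∪ C₂ := by
    have hsub : C₃ ∪ C₂ ⊆ C₁ ∪ C₂ := Finset.union_subset s3 Finset.subset_union_right
    by_contra hx
    obtain ⟨C, a, b, c⟩ := ih _ (hn ▸ Finset.card_lt_card (Finset.ssubset_iff_subset_ne.2 ⟨hsub, hx⟩))
      C₃ C₂ rfl c3 h2 e3 hh ⟨g', Finset.mem_inter.2 ⟨hg'3, hg'2⟩⟩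
    exact hno C a b c
  obtain ⟨C₄, c4, s4, g4, h4⟩ := strong_elim h2 c3 hg'2 hg'3 hh hh3
  obtain ⟨k, hk4, hk2⟩ : ∃ k ∈ C₄, k ∉ C₂ := by
    by_contra hx
    push Not at hx
    have := circuit_not_ssub h2 c4 hx
    exact g4 (this ▸ hg'2)
  have hs4 : C₄ ⊆ C₁ ∪ C₂ := by rw [← hun, Finset.union_comm]; exact s4
  have hk1 : k ∈ C₁ := by
    have := hs4 hk4
    rw [Finset.mem_union] at this
    tauto
  have hlt : C₁ ∪ C₄ ⊂ C₁ ∪ C₂ := by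
    rw [Finset.ssubset_iff_of_subset (Finset.union_subset Finset.subset_union_left hs4)]
    exact ⟨g', Finset.mem_union_right _ hg'2, by simp [hg'1, g4]⟩
  obtain ⟨C, a, b, c⟩ := ih _ (hn ▸ Finset.card_lt_card hlt) C₁ C₄ rfl h1 c4 he h4
    ⟨k, Finset.mem_inter.2 ⟨hk1, hk4⟩⟩
  exact hno C a b c

/-- Coordinate projection onto `F`. -/
def proj (F : Finset E) (v : E → K) : E → K := fun e => if e ∈ F then v e else 0

theorem proj_add (F : Finset E) (u v : E → K) : proj F (u + v) = proj F u + proj F v := by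
  funext e; by_cases h : e ∈ F <;> simp [proj, h]

theorem proj_smul (F : Finset E) (c : K) (v : E → K) : proj F (c • v) = c • proj F v := by
  funext e; by_cases h : e ∈ F <;> simp [proj, h]

theorem proj_dot (F : Finset E) (u v : E → K) : proj F u ⬝ᵥ v = u ⬝ᵥ proj F v := by
  simp only [dotProduct, proj]
  refine Finset.sum_congr rfl fun e _ => ?_
  by_cases h : e ∈ F <;> simp [h]

theorem mem_suppOn {F : Finset E} {v : E → K} : v ∈ suppOn F ↔ ∀ e, e ∉ F → v e = 0 := by
  rw [suppOn, LinearMap.mem_ker]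
  constructor
  · intro h e he
    exact congrFun h ⟨e, he⟩
  · intro h
    funext e
    exact h e e.2

theorem proj_mem_suppOn (F : Finset E) (v : E → K) : proj F v ∈ suppOn F :=
  mem_suppOn.2 fun e he => by simp [proj, he]

theorem proj_rel {W : Submodule K (E → K)} {F : Finset E}
    (h : ∀ C, IsCircuit W C → C ⊆ F ∨ Disjoint C F) :
    ∀ (n : ℕ) (u : E → K), (supp u).card = n → u ∈ rel W → proj F u ∈ rel W := by
  intro n
  induction n using Nat.strong_induction_on with
  | _ n ih =>
  intro u hn hu
  by_cases hne : u = 0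
  · subst hne
    have : proj F (0 : E → K) = 0 := by funext e; simp [proj]
    rw [this]; exact zero_mem _
  rcases circuit_or hu hne with hc | ⟨y, hy, hy0, hs⟩
  · rcases h _ hc with h1 | h1
    · have : proj F u = u := by
        funext e
        by_cases he : e ∈ F
        · simp [proj, he]
        · have : u e = 0 := by by_contra hx; exact he (h1 (mem_supp.2 hx))
          simp [proj, this]
      rw [this]; exact hu
    · have : proj F u = 0 := by
        funext e
        by_cases he : e ∈ F
        · have : u e = 0 := by
            by_contra hx; exact Finset.disjoint_left.1 h1 (mem_supp.2 hx) he
          simp [proj, this]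
        · simp [proj, he]
      rw [this]; exact zero_mem _
  · obtain ⟨k, hk⟩ := exists_mem_supp hy0
    have hlt := supp_elim hs hk
    have h1 := ih _ (hn ▸ Finset.card_lt_card hlt) _ rfl
        ((rel W).sub_mem hu ((rel W).smul_mem _ hy))
    have h2 := ih _ (hn ▸ Finset.card_lt_card hs) y rfl hy
    have h3 : u = (u - (u k / y k) • y) + (u k / y k) • y := by simp
    rw [h3, proj_add, proj_smul]
    exact (rel W).add_mem h1 ((rel W).smul_mem _ h2)

theorem proj_mem {W : Submodule K (E → K)} {F : Finset E}
    (h : ∀ C, IsCircuit W C → C ⊆ F ∨ Disjoint C F) {v : E → K} (hv : v ∈ W) :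
    proj F v ∈ W := by
  by_contra hn
  obtain ⟨f, hf, hker⟩ := Submodule.exists_le_ker_of_notMem hn
  let u : E → K := fun e => f (fun j => if e = j then 1 else 0)
  have hdot : ∀ x, f x = u ⬝ᵥ x := by
    intro x
    rw [LinearMap.pi_apply_eq_sum_univ f x, dotProduct]
    refine Finset.sum_congr rfl fun e _ => ?_
    rw [smul_eq_mul, mul_comm]
  have hu : u ∈ rel W := fun x hx => by rw [← hdot]; exact hker hx
  apply hf
  rw [hdot, ← proj_dot]
  exact proj_rel h _ u rfl hu v hv

theorem psi_change {r : ℕ} (w w' : Fin r → E → K) (hw : LinearIndependent K w)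
    (hs : ∀ k, w k ∈ Submodule.span K (Set.range w')) :
    ∃ c : K, c ≠ 0 ∧ psi w = MvPolynomial.C (c ^ 2) * psi w' := by
  have : ∀ k, ∃ c : Fin r → K, ∑ l, c l • w' l = w k := fun k =>
    (Submodule.mem_span_range_iff_exists_fun K).1 (hs k)
  choose P hP using this
  refine ⟨(Matrix.of P).det, ?_, ?_⟩
  · intro h0
    obtain ⟨c, hc, hc0⟩ := Matrix.exists_vecMul_eq_zero_iff.2 h0
    apply hc
    have := Fintype.linearIndependent_iff.1 hw c (by
      simp_rw [← hP, Finset.smul_sum, smul_smul]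
      rw [Finset.sum_comm]
      refine Finset.sum_eq_zero fun l _ => ?_
      rw [← Finset.sum_smul]
      have := congrFun hc0 l
      simp only [Matrix.vecMul, dotProduct, Matrix.of_apply, Pi.zero_apply] at this
      rw [this, zero_smul])
    exact funext this
  · have hQ : Qform w = (Matrix.of P).map MvPolynomial.C * Qform w' *
        ((Matrix.of P).map MvPolynomial.C).transpose := by
      ext1 i j
      simp only [Qform, Matrix.mul_apply, Matrix.map_apply, Matrix.of_apply,
        Matrix.transpose_apply]
      simp_rw [← hP, Finset.sum_apply, Pi.smul_apply, smul_eq_mul, Finset.sum_mul_sum,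
        Finset.mul_sum, Finset.sum_mul, map_sum, Finset.sum_mul]
      rw [Finset.sum_comm]
      conv_rhs => rw [Finset.sum_comm]
      refine Finset.sum_congr rfl fun a _ => ?_
      conv_rhs => rw [Finset.sum_comm]
      refine Finset.sum_congr rfl fun e _ => ?_
      refine Finset.sum_congr rfl fun b _ => ?_
      simp only [map_mul]
      ring
    rw [psi_eq_det, psi_eq_det, hQ, Matrix.det_mul, Matrix.det_mul, Matrix.det_transpose,
      ← RingHom.mapMatrix_apply, ← RingHom.map_det, MvPolynomial.C_pow]
    ring

theorem det_bd {R : Type} [CommRing R] {n : ℕ} {rr : Fin n → ℕ}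
    (M : (i : Fin n) → Matrix (Fin (rr i)) (Fin (rr i)) R) :
    (Matrix.blockDiagonal' M).det = ∏ i, (M i).det := by
  have hbt : (Matrix.blockDiagonal' M).BlockTriangular Sigma.fst :=
    Matrix.blockTriangular_blockDiagonal' M
  rw [hbt.det_fintype]
  refine Finset.prod_congr rfl fun i _ => ?_
  rw [← Matrix.det_submatrix_equiv_self (Equiv.sigmaSubtype i).symm]
  congr 1
  ext1 a b
  exact Matrix.blockDiagonal'_apply_eq M i a b

theorem psi_factor {W : Submodule K (E → K)} {r : ℕ} {w : Fin r → E → K}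
    (hw : IsBasisOf w W) {n : ℕ} (Epart : Fin n → Finset E) (rr : Fin n → ℕ)
    (ww : (i : Fin n) → Fin (rr i) → E → K)
    (hdis : ∀ i j, i ≠ j → Disjoint (Epart i) (Epart j))
    (hcov : Finset.univ.biUnion Epart = Finset.univ)
    (hproj : ∀ i, ∀ v ∈ W, proj (Epart i) v ∈ W)
    (hww : ∀ i, IsBasisOf (ww i) (W ⊓ suppOn (Epart i))) :
    ∃ c : K, c ≠ 0 ∧ psi w = MvPolynomial.C (c ^ 2) * ∏ i : Fin n, psi (ww i) := by
  classical
  let w' : (Σ i, Fin (rr i)) → E → K := fun s => ww s.1 s.2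
  have hmem : ∀ i a, ww i a ∈ W ⊓ suppOn (Epart i) := fun i a => by
    rw [← (hww i).2]; exact Submodule.subset_span ⟨a, rfl⟩
  have hz : ∀ i a e, e ∉ Epart i → ww i a e = 0 := fun i a => mem_suppOn.1 (hmem i a).2
  have hli : LinearIndependent K w' := by
    rw [Fintype.linearIndependent_iff]
    rintro g hg ⟨j, a⟩
    refine Fintype.linearIndependent_iff.1 (hww j).1 (fun a => g ⟨j, a⟩) ?_ a
    funext e
    by_cases he : e ∈ Epart j
    · have h1 := congrFun hg e
      rw [Fintype.sum_sigma, Finset.sum_apply,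
        Finset.sum_eq_single_of_mem j (Finset.mem_univ _)] at h1
      · exact h1
      · intro i _ hij
        rw [Finset.sum_apply]
        refine Finset.sum_eq_zero fun b _ => ?_
        have := hz i b e (Finset.disjoint_right.1 (hdis i j hij) he)
        simp [w', this]
    · simp [hz j _ e he]
  have hsp : Submodule.span K (Set.range w') = W := by
    apply le_antisymm
    · rw [Submodule.span_le]
      rintro _ ⟨s, rfl⟩
      exact (hmem s.1 s.2).1
    · intro v hv
      have hsum : v = ∑ i, proj (Epart i) v := by
        funext e
        have : e ∈ Finset.univ.biUnion Epart := by rw [hcov]; exact Finset.mem_univ _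
        obtain ⟨j, _, hj⟩ := Finset.mem_biUnion.1 this
        rw [Finset.sum_apply, Finset.sum_eq_single_of_mem j (Finset.mem_univ _)]
        · simp [proj, hj]
        · intro i _ hij
          have := Finset.disjoint_right.1 (hdis i j hij) hj
          simp [proj, this]
      rw [hsum]
      refine Submodule.sum_mem _ fun i _ => ?_
      have h1 : proj (Epart i) v ∈ W ⊓ suppOn (Epart i) := ⟨hproj i v hv, proj_mem_suppOn _ _⟩
      rw [← (hww i).2] at h1
      refine Submodule.span_mono ?_ h1
      rintro _ ⟨a, rfl⟩
      exact ⟨⟨i, a⟩, rfl⟩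
  have hcard : Fintype.card (Fin r) = Fintype.card (Σ i, Fin (rr i)) := by
    rw [← finrank_span_eq_card hw.1, ← finrank_span_eq_card hli, hw.2, hsp]
  let ε : Fin r ≃ (Σ i, Fin (rr i)) := Fintype.equivOfCardEq hcard
  obtain ⟨c, hc, h⟩ := psi_change w (w' ∘ ε) hw.1 (fun k => by
    rw [ε.surjective.range_comp, hsp, ← hw.2]
    exact Submodule.subset_span ⟨k, rfl⟩)
  refine ⟨c, hc, ?_⟩
  rw [h]
  congr 1
  simp_rw [psi_eq_det]
  rw [← det_bd, ← Matrix.det_submatrix_equiv_self ε]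
  congr 1
  ext1 k l
  rw [Matrix.submatrix_apply]
  generalize hs : ε k = s
  generalize ht : ε l = t
  obtain ⟨i, a⟩ := s
  obtain ⟨j, b⟩ := t
  change ∑ e : E, MvPolynomial.C (w' (ε k) e * w' (ε l) e) * MvPolynomial.X e = _
  rw [hs, ht]
  change ∑ e : E, MvPolynomial.C (ww i a e * ww j b e) * MvPolynomial.X e = _
  by_cases hij : i = j
  · subst hij
    rw [Matrix.blockDiagonal'_apply_eq]
    rfl
  · rw [Matrix.blockDiagonal'_apply_ne _ _ _ hij]
    refine Finset.sum_eq_zero fun e _ => ?_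
    have : ww i a e * ww j b e = 0 := by
      by_cases he : e ∈ Epart i
      · rw [hz j b e (Finset.disjoint_left.1 (hdis i j hij) he), mul_zero]
      · rw [hz i a e he, zero_mul]
    rw [this, map_zero, zero_mul]

theorem mem_rel_basis {V : Submodule K (E → K)} {r : ℕ} {w : Fin r → E → K}
    (hw : IsBasisOf w V) {u : E → K} : u ∈ rel V ↔ ∀ i, u ⬝ᵥ w i = 0 := by
  constructor
  · intro h i
    exact h _ (by rw [← hw.2]; exact Submodule.subset_span ⟨i, rfl⟩)
  · intro h v hv
    rw [← hw.2] at hv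
    induction hv using Submodule.span_induction with
    | mem x hx => obtain ⟨i, rfl⟩ := hx; exact h i
    | zero => simp
    | add x y _ _ hx hy => rw [dotProduct_add, hx, hy, add_zero]
    | smul a x _ hx => rw [dotProduct_smul, hx, smul_zero]

theorem cSq_ne_zero_iff {V : Submodule K (E → K)} {r : ℕ} {w : Fin r → E → K}
    (hw : IsBasisOf w V) {B : Finset E} : cSq w B ≠ 0 ↔ B.card = r ∧ Indep V B := by
  by_cases hc : B.card = r
  swap
  · simp [cSq, hc]
  simp only [cSq, hc, true_and]
  let e0 : Fin r ≃ B := (Finset.equivFinOfCardEq hc).symm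
  change (Matrix.det (Matrix.of fun i j : Fin r => w i (e0 j : E))) ^ 2 ≠ 0 ↔ _
  rw [Ne, pow_eq_zero_iff two_ne_zero, ← Matrix.exists_mulVec_eq_zero_iff, indep_iff]
  have key : ∀ (u : E → K), (∀ e, e ∉ B → u e = 0) → ∀ i,
      u ⬝ᵥ w i = ∑ j, w i (e0 j) * u (e0 j) := by
    intro u hu i
    rw [dotProduct, ← Finset.sum_subset (Finset.subset_univ B)
        (fun e _ he => by rw [hu e he, zero_mul]), ← Finset.sum_coe_sort B, ← Equiv.sum_comp e0]
    exact Finset.sum_congr rfl fun j _ => mul_comm _ _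
  push Not
  constructor
  · intro h u hu hS
    by_contra hne
    refine h (fun j => u (e0 j)) ?_ ?_
    · intro h0
      apply hne
      funext e
      by_cases he : e ∈ B
      · have := congrFun h0 (e0.symm ⟨e, he⟩)
        simpa using this
      · exact hS e he
    · funext i
      have := (mem_rel_basis hw).1 hu i
      rw [key u hS i] at this
      exact this
  · intro h c hc0 hM
    let u : E → K := fun e => if he : e ∈ B then c (e0.symm ⟨e, he⟩) else 0
    have hS : ∀ e, e ∉ B → u e = 0 := fun e he => by simp [u, he]
    have hue : ∀ j, u (e0 j) = c j := fun j => by simp [u]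
    have := h u ((mem_rel_basis hw).2 (fun i => by
      rw [key u hS i]
      simp_rw [hue]
      exact congrFun hM i)) hS
    exact hc0 (funext fun j => by rw [← hue, this]; rfl)

theorem finrank_basis {V : Submodule K (E → K)} {r : ℕ} {w : Fin r → E → K}
    (hw : IsBasisOf w V) : Module.finrank K V = r := by
  rw [← hw.2, finrank_span_eq_card hw.1, Fintype.card_fin]

theorem exists_basis_extension {V : Submodule K (E → K)} {S : Finset E} (hS : Indep V S) :
    ∃ B, S ⊆ B ∧ B.card = Module.finrank K V ∧ Indep V B := by
  classical
  obtain ⟨B, hB, hmax⟩ := Finset.exists_max_image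
    (Finset.univ.filter fun B : Finset E => S ⊆ B ∧ Indep V B) Finset.card ⟨S, by simp [hS]⟩
  simp only [Finset.mem_filter, Finset.mem_univ, true_and] at hB hmax
  refine ⟨B, hB.1, le_antisymm ?_ ?_, hB.2⟩
  · have := LinearIndependent.fintype_card_le_finrank hB.2
    rwa [Fintype.card_coe, Subspace.dual_finrank_eq] at this
  · by_contra hlt
    push Not at hlt
    let f : V →ₗ[K] (B → K) := LinearMap.pi fun e => coordFun V e
    have hker : LinearMap.ker f ≠ ⊥ := LinearMap.ker_ne_bot_of_finrank_lt (by
      rw [Module.finrank_fintype_fun_eq_card, Fintype.card_coe]; exact hlt)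
    obtain ⟨v, hv, hv0⟩ := Submodule.exists_mem_ne_zero_of_ne_bot hker
    have hvB : ∀ e ∈ B, (v : E → K) e = 0 := fun e he =>
      congrFun (LinearMap.mem_ker.1 hv) ⟨e, he⟩
    obtain ⟨x, hx⟩ : ∃ x, (v : E → K) x ≠ 0 := by
      by_contra hn
      push Not at hn
      exact hv0 (Subtype.ext (funext hn))
    have hxB : x ∉ B := fun h => hx (hvB x h)
    have hi : Indep V (insert x B) := by
      rw [indep_iff]
      intro u hu hs
      have h1 := hu v v.2
      rw [dotProduct, Finset.sum_eq_single_of_mem x (Finset.mem_univ _)] at h1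
      · have hux : u x = 0 := by
          rcases mul_eq_zero.1 h1 with h | h
          · exact h
          · exact absurd h hx
        refine indep_iff.1 hB.2 u hu fun e he => ?_
        by_cases hex : e = x
        · rw [hex, hux]
        · exact hs e (by simp [hex, he])
      · intro e _ hex
        by_cases he : e ∈ B
        · rw [hvB e he, mul_zero]
        · rw [hs e (by simp [hex, he]), zero_mul]
    have := hmax (insert x B) ⟨hB.1.trans (Finset.subset_insert _ _), hi⟩
    rw [Finset.card_insert_of_notMem hxB] at this
    omega

/-- Exponent vector of the squarefree monomial of `B`. -/
noncomputable def mon (B : Finset E) : E →₀ ℕ := ∑ e ∈ B, Finsupp.single e 1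

theorem mon_apply (B : Finset E) (a : E) : mon B a = if a ∈ B then 1 else 0 := by
  simp [mon, Finsupp.finsetSum_apply, Finsupp.single_apply]

theorem mon_inj {B B' : Finset E} (h : mon B = mon B') : B = B' := by
  ext a
  have := DFunLike.congr_fun h a
  rw [mon_apply, mon_apply] at this
  by_cases h1 : a ∈ B <;> by_cases h2 : a ∈ B' <;> simp_all

theorem psi_eq_sum {r : ℕ} (w : Fin r → E → K) :
    psi w = ∑ B ∈ Finset.univ.powersetCard r, MvPolynomial.monomial (mon B) (cSq w B) := by
  rw [psi]
  refine Finset.sum_congr rfl fun B _ => ?_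
  rw [mon, MvPolynomial.monomial_sum_index]
  rfl

theorem coeff_mon {r : ℕ} (w : Fin r → E → K) (B : Finset E) :
    MvPolynomial.coeff (mon B) (psi w) = cSq w B := by
  rw [psi_eq_sum, MvPolynomial.coeff_sum]
  simp_rw [MvPolynomial.coeff_monomial]
  by_cases hc : B.card = r
  · rw [Finset.sum_eq_single_of_mem B (by simp [Finset.mem_powersetCard, hc])]
    · simp
    · intro B' _ hne
      rw [if_neg fun h => hne (mon_inj h)]
  · rw [cSq, dif_neg hc]
    refine Finset.sum_eq_zero fun B' hB' => ?_
    rw [if_neg]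
    intro h
    rw [mon_inj h, Finset.mem_powersetCard] at hB'
    exact hc hB'.2

theorem mem_support_psi {r : ℕ} {w : Fin r → E → K} {m : E →₀ ℕ}
    (hm : m ∈ (psi w).support) : ∃ B, m = mon B ∧ cSq w B ≠ 0 := by
  have hm' := MvPolynomial.mem_support_iff.1 hm
  have hex : ∃ B, m = mon B := by
    by_contra hn
    push Not at hn
    apply hm'
    rw [psi_eq_sum, MvPolynomial.coeff_sum]
    refine Finset.sum_eq_zero fun B _ => ?_
    rw [MvPolynomial.coeff_monomial, if_neg fun h => hn B h.symm]
  obtain ⟨B, rfl⟩ := hex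
  rw [coeff_mon] at hm'
  exact ⟨B, rfl, hm'⟩

theorem psi_not_unit {r : ℕ} (hr : 1 ≤ r) (w : Fin r → E → K) : ¬ IsUnit (psi w) := by
  intro h
  have h1 := h.map (MvPolynomial.constantCoeff (R := K) (σ := E))
  have h0 : mon (∅ : Finset E) = 0 := by simp [mon]
  rw [MvPolynomial.constantCoeff_eq, ← h0, coeff_mon, cSq, dif_neg (by simp; omega)] at h1
  exact not_isUnit_zero h1

theorem psi_ne_zero {V : Submodule K (E → K)} {r : ℕ} {w : Fin r → E → K}
    (hw : IsBasisOf w V) : psi w ≠ 0 := by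
  have h0 : Indep V ∅ := indep_iff.2 fun u _ h => funext fun e => h e (by simp)
  obtain ⟨B, -, hc, hB⟩ := exists_basis_extension h0
  rw [finrank_basis hw] at hc
  have h1 := (cSq_ne_zero_iff hw).2 ⟨hc, hB⟩
  rw [← coeff_mon] at h1
  intro h
  exact h1 (by rw [h]; simp)

theorem psi_rank_zero {r : ℕ} (hr : r = 0) (w : Fin r → E → K) : psi w = 1 := by
  subst hr
  rw [psi_eq_det, Matrix.det_isEmpty]

theorem exists_degreeOf {p : MvPolynomial E K} (h0 : p ≠ 0) (hu : ¬ IsUnit p) :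
    ∃ e, p.degreeOf e ≠ 0 := by
  by_contra hn
  push Not at hn
  have h1 : p.totalDegree = 0 := by
    rw [MvPolynomial.totalDegree_eq_zero_iff]
    intro m hm x
    have := MvPolynomial.monomial_le_degreeOf x hm
    rw [hn x] at this
    omega
  rw [MvPolynomial.totalDegree_eq_zero_iff_eq_C] at h1
  apply hu
  rw [h1]
  refine IsUnit.map _ (isUnit_iff_ne_zero.2 fun h => h0 ?_)
  rw [h1, h, map_zero]

theorem coeff_sep {p q : MvPolynomial E K} (A : E → Prop)
    (hp : ∀ m ∈ p.support, ∀ a, ¬ A a → m a = 0) (hq : ∀ m ∈ q.support, ∀ a, A a → m a = 0)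
    {m₁ m₂ : E →₀ ℕ} (h1 : m₁ ∈ p.support) (h2 : m₂ ∈ q.support) :
    MvPolynomial.coeff (m₁ + m₂) (p * q) ≠ 0 := by
  rw [MvPolynomial.coeff_mul, Finset.sum_eq_single_of_mem (m₁, m₂) (by simp)]
  · exact mul_ne_zero (MvPolynomial.mem_support_iff.1 h1) (MvPolynomial.mem_support_iff.1 h2)
  · rintro ⟨x, y⟩ hxy hne
    by_contra hc
    apply hne
    have hx : x ∈ p.support := MvPolynomial.mem_support_iff.2 (left_ne_zero_of_mul hc)
    have hy : y ∈ q.support := MvPolynomial.mem_support_iff.2 (right_ne_zero_of_mul hc)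
    rw [Finset.HasAntidiagonal.mem_antidiagonal] at hxy
    have hs : ∀ a, x a + y a = m₁ a + m₂ a := fun a => DFunLike.congr_fun hxy a
    have : ∀ a, x a = m₁ a ∧ y a = m₂ a := by
      intro a
      have := hs a
      by_cases ha : A a
      · have e1 := hq _ hy a ha
        have e2 := hq _ h2 a ha
        omega
      · have e1 := hp _ hx a ha
        have e2 := hp _ h1 a ha
        omega
    exact Prod.ext (Finsupp.ext fun a => (this a).1) (Finsupp.ext fun a => (this a).2)

theorem irreducible_psi {V : Submodule K (E → K)} {r : ℕ} {w : Fin r → E → K}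
    (hw : IsBasisOf w V) (hr : 1 ≤ r) {F : Finset E} (hF : V ≤ suppOn F)
    (hconn : ∀ e ∈ F, ∀ f ∈ F, e ≠ f → ∃ C : Finset E, IsCircuit V C ∧ e ∈ C ∧ f ∈ C) :
    Irreducible (psi w) := by
  refine ⟨psi_not_unit hr w, ?_⟩
  intro p q hpq
  have hne := psi_ne_zero hw
  have hp0 : p ≠ 0 := by rintro rfl; exact hne (by rw [hpq, zero_mul])
  have hq0 : q ≠ 0 := by rintro rfl; exact hne (by rw [hpq, mul_zero])
  by_contra hu
  rw [not_or] at hu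
  obtain ⟨e, he⟩ := exists_degreeOf hp0 hu.1
  obtain ⟨f, hf⟩ := exists_degreeOf hq0 hu.2
  have hdeg : ∀ a, p.degreeOf a + q.degreeOf a ≤ 1 := by
    intro a
    rw [← MvPolynomial.degreeOf_mul_eq hp0 hq0, ← hpq, MvPolynomial.degreeOf_le_iff]
    intro m hm
    obtain ⟨B, rfl, -⟩ := mem_support_psi hm
    rw [mon_apply]; split_ifs <;> simp
  have hinF : ∀ a, p.degreeOf a + q.degreeOf a ≠ 0 → a ∈ F := by
    intro a ha
    rw [← MvPolynomial.degreeOf_mul_eq hp0 hq0, ← hpq] at ha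
    have : ∃ m ∈ (psi w).support, m a ≠ 0 := by
      by_contra hn
      push Not at hn
      exact ha (Nat.le_zero.1 (MvPolynomial.degreeOf_le_iff.2 fun m hm => (hn m hm).le))
    obtain ⟨m, hm, hma⟩ := this
    obtain ⟨B, rfl, hB⟩ := mem_support_psi hm
    have haB : a ∈ B := by
      by_contra h; exact hma (by simp [mon_apply, h])
    by_contra haF
    have hi := indep_iff.1 ((cSq_ne_zero_iff hw).1 hB).2 (Pi.single a 1)
      (fun v hv => by
        rw [single_dotProduct, mem_suppOn.1 (hF hv) a haF, mul_zero])
      (fun x hx => by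
        have : x ≠ a := fun h => hx (h ▸ haB)
        simp [this])
    have := congrFun hi a
    simp at this
  have hef : e ≠ f := by
    rintro rfl
    have := hdeg e
    omega
  obtain ⟨C, hC, heC, hfC⟩ := hconn e (hinF e (by omega)) f (hinF f (by omega)) hef
  obtain ⟨x, hx, rfl⟩ := circuit_vec hC
  obtain ⟨B, hSB, hBc, hB⟩ := exists_basis_extension (hC.2 _ (Finset.erase_ssubset heC))
  rw [finrank_basis hw] at hBc
  have hfB : f ∈ B := hSB (Finset.mem_erase.2 ⟨hef.symm, hfC⟩)
  have heB : e ∉ B := by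
    intro h
    have : x = 0 := indep_iff.1 hB x hx fun a ha => by
      by_contra hxa
      by_cases hae : a = e
      · exact ha (hae ▸ h)
      · exact ha (hSB (Finset.mem_erase.2 ⟨hae, mem_supp.2 hxa⟩))
    exact mem_supp.1 heC (by rw [this]; rfl)
  have hxB : ∀ a, a ∉ B → a ≠ e → x a = 0 := fun a ha hae => by
    by_contra hxa
    exact ha (hSB (Finset.mem_erase.2 ⟨hae, mem_supp.2 hxa⟩))
  have hB' : Indep V (insert e (B.erase f)) := by
    rw [indep_iff]
    intro u hu hs
    have hxe := mem_supp.1 heC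
    have hxf := mem_supp.1 hfC
    have h0 : u - (u e / x e) • x = 0 := by
      refine indep_iff.1 hB _ ((rel V).sub_mem hu ((rel V).smul_mem _ hx)) fun a ha => ?_
      by_cases hae : a = e
      · subst hae; simp [hxe]
      · have h1 : u a = 0 := hs a (by simp [hae, ha])
        simp [h1, hxB a ha hae]
    have hfu : u f = 0 := hs f (by simp [hef.symm])
    have h1 := congrFun h0 f
    simp only [Pi.sub_apply, Pi.smul_apply, smul_eq_mul, Pi.zero_apply, hfu, zero_sub,
      neg_eq_zero, mul_eq_zero, hxf, or_false] at h1
    rw [h1, zero_smul, sub_zero] at h0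
    exact h0
  have hBc' : (insert e (B.erase f)).card = r := by
    rw [Finset.card_insert_of_notMem (by simp [heB]), Finset.card_erase_of_mem hfB]
    omega
  have key : ∀ B : Finset E, cSq w B ≠ 0 → ∃ m₁ ∈ p.support, ∃ m₂ ∈ q.support,
      m₁ + m₂ = mon B := by
    intro B hB
    rw [← coeff_mon, hpq, MvPolynomial.coeff_mul] at hB
    obtain ⟨⟨a, b⟩, hab, hn⟩ := Finset.exists_ne_zero_of_sum_ne_zero hB
    exact ⟨a, MvPolynomial.mem_support_iff.2 (left_ne_zero_of_mul hn), b,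
      MvPolynomial.mem_support_iff.2 (right_ne_zero_of_mul hn), Finset.HasAntidiagonal.mem_antidiagonal.1 hab⟩
  obtain ⟨m₁, h1, m₂, h2, h12⟩ := key B ((cSq_ne_zero_iff hw).2 ⟨hBc, hB⟩)
  obtain ⟨n₁, k1, n₂, k2, k12⟩ := key _ ((cSq_ne_zero_iff hw).2 ⟨hBc', hB'⟩)
  have hp : ∀ m ∈ p.support, ∀ a, ¬ (p.degreeOf a ≠ 0) → m a = 0 := by
    intro m hm a ha
    have := MvPolynomial.monomial_le_degreeOf a hm
    omega
  have hq : ∀ m ∈ q.support, ∀ a, p.degreeOf a ≠ 0 → m a = 0 := by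
    intro m hm a ha
    have := MvPolynomial.monomial_le_degreeOf a hm
    have := hdeg a
    omega
  have hcoef := coeff_sep (fun a => p.degreeOf a ≠ 0) hp hq h1 k2
  have hm : m₁ + n₂ = mon (B.erase f) := by
    ext a
    have e1 : m₁ a + m₂ a = mon B a := DFunLike.congr_fun h12 a
    have e2 : n₁ a + n₂ a = mon (insert e (B.erase f)) a := DFunLike.congr_fun k12 a
    rw [Finsupp.add_apply]
    by_cases ha : p.degreeOf a ≠ 0
    · have haf : a ≠ f := by
        rintro rfl
        have := hdeg a
        omega
      rw [hq _ k2 a ha]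
      rw [hq _ h2 a ha] at e1
      rw [e1, mon_apply, mon_apply]
      simp [haf]
    · have hae : a ≠ e := by
        rintro rfl
        exact ha he
      rw [hp _ h1 a ha]
      rw [hp _ k1 a ha] at e2
      rw [e2, mon_apply, mon_apply]
      simp [hae]
  rw [← hpq, hm, coeff_mon] at hcoef
  have := ((cSq_ne_zero_iff hw).1 hcoef).1
  rw [Finset.card_erase_of_mem hfB] at this
  omega

theorem exists_basisOf (V : Submodule K (E → K)) :
    ∃ (r : ℕ) (w : Fin r → E → K), IsBasisOf w V := by
  let b := Module.finBasis K V
  refine ⟨_, fun i => (b i : E → K), ?_, ?_⟩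
  · exact b.linearIndependent.map' V.subtype (Submodule.ker_subtype V)
  · have : Set.range (fun i => (b i : E → K)) = Set.image V.subtype (Set.range b) := by
      rw [← Set.range_comp]; rfl
    rw [this, Submodule.span_image, b.span_eq, Submodule.map_top, Submodule.range_subtype]

theorem not_connected_loop {W : Submodule K (E → K)} {r : ℕ} {w : Fin r → E → K}
    (hw : IsBasisOf w W) {A : Finset E} {e f : E} (heA : e ∈ A) (hfA : f ∉ A)
    (hA : ∀ C, IsCircuit W C → C ⊆ A ∨ Disjoint C A) (hirr : Irreducible (psi w))
    (hloop : ∀ e : E, Indep W {e}) : False := by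
  have hA' : ∀ C, IsCircuit W C → C ⊆ Aᶜ ∨ Disjoint C Aᶜ := by
    intro C hC
    rcases hA C hC with h | h
    · right
      exact Finset.disjoint_left.2 fun x hx hx' => Finset.mem_compl.1 hx' (h hx)
    · left
      exact fun x hx => Finset.mem_compl.2 (Finset.disjoint_left.1 h hx)
  let P : Fin 2 → Finset E := ![A, Aᶜ]
  have hb : ∀ i, ∃ (r : ℕ) (w : Fin r → E → K), IsBasisOf w (W ⊓ suppOn (P i)) :=
    fun i => exists_basisOf _
  choose rr ww hww using hb
  have hproj : ∀ i, ∀ v ∈ W, proj (P i) v ∈ W := by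
    intro i v hv
    fin_cases i
    · exact proj_mem hA hv
    · exact proj_mem hA' hv
  obtain ⟨c, hc, h⟩ := psi_factor hw P rr ww (by
      intro i j hij
      fin_cases i <;> fin_cases j
      · exact absurd rfl hij
      · exact disjoint_compl_right
      · exact disjoint_compl_left
      · exact absurd rfl hij) (by
      ext x
      simp only [Finset.mem_biUnion, Finset.mem_univ, true_and, iff_true]
      by_cases hx : x ∈ A
      · exact ⟨0, hx⟩
      · exact ⟨1, Finset.mem_compl.2 hx⟩) hproj hww
  have hzero : ∀ i, IsUnit (psi (ww i)) → ∀ x ∈ P i, False := by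
    intro i hi x hx
    have hr0 : rr i = 0 := by
      by_contra hn
      exact psi_not_unit (Nat.one_le_iff_ne_zero.2 hn) _ hi
    have hbot : W ⊓ suppOn (P i) = ⊥ := by
      rw [← Submodule.finrank_eq_zero (R := K), finrank_basis (hww i), hr0]
    have := indep_iff.1 (hloop x) (Pi.single x 1) (fun v hv => by
      have h1 : proj (P i) v ∈ W ⊓ suppOn (P i) := ⟨hproj i v hv, proj_mem_suppOn _ _⟩
      rw [hbot, Submodule.mem_bot] at h1
      have h2 := congrFun h1 x
      simp only [proj, hx, if_true] at h2
      rw [single_dotProduct, h2]; simp) (fun y hy => by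
        have : y ≠ x := by simpa using hy
        simp [this])
    have := congrFun this x
    simp at this
  rw [Fin.prod_univ_two, ← mul_assoc] at h
  rcases hirr.isUnit_or_isUnit h with h1 | h1
  · exact hzero 0 (isUnit_of_mul_isUnit_right h1) e heA
  · exact hzero 1 h1 f (Finset.mem_compl.2 hfA)

theorem connected_of_irreducible {W : Submodule K (E → K)} {r : ℕ} {w : Fin r → E → K}
    (hw : IsBasisOf w W) (hirr : Irreducible (psi w))
    (hloop : ∀ e : E, Indep W {e}) {e f : E} (hef : e ≠ f) :
    ∃ C : Finset E, IsCircuit W C ∧ e ∈ C ∧ f ∈ C := by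
  classical
  by_contra hno
  let A : Finset E := Finset.univ.filter fun g => g = e ∨ ∃ C, IsCircuit W C ∧ e ∈ C ∧ g ∈ C
  have hmA : ∀ g, g ∈ A ↔ (g = e ∨ ∃ C, IsCircuit W C ∧ e ∈ C ∧ g ∈ C) := by
    intro g; simp [A]
  refine not_connected_loop hw (A := A) (e := e) (f := f) ((hmA e).2 (Or.inl rfl)) ?_ ?_
    hirr hloop
  · rw [hmA]
    rintro (h | h)
    · exact hef h.symm
    · exact hno h
  · intro C hC
    by_cases hd : Disjoint C A
    · exact Or.inr hd
    left
    rw [Finset.not_disjoint_iff] at hd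
    obtain ⟨g, hgC, hgA⟩ := hd
    intro h hh
    rw [hmA]
    right
    rcases (hmA g).1 hgA with rfl | ⟨D, hD, heD, hgD⟩
    · exact ⟨C, hC, hgC, hh⟩
    · exact circuit_trans _ D C rfl hD hC heD hh ⟨g, Finset.mem_inter.2 ⟨hgD, hgC⟩⟩

theorem loopless_of_connected {W : Submodule K (E → K)} {r : ℕ} {w : Fin r → E → K}
    (hw : IsBasisOf w W) (hr : 1 ≤ r) (hc : Connected W) (e : E) : Indep W {e} := by
  by_cases hex : ∃ f, f ≠ e
  · obtain ⟨f, hf⟩ := hex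
    obtain ⟨C, hC, h1, h2⟩ := hc.2 f e hf
    refine hC.2 _ ?_
    rw [Finset.ssubset_iff_of_subset (by simpa using h2)]
    exact ⟨f, h1, by simpa using hf⟩
  · push Not at hex
    rw [indep_iff]
    intro u hu _
    have h0 := hw.1.ne_zero (⟨0, hr⟩ : Fin r)
    have h1 := (mem_rel_basis hw).1 hu ⟨0, hr⟩
    have huniv : (Finset.univ : Finset E) = {e} := by
      ext x; simp [hex x]
    rw [dotProduct, huniv, Finset.sum_singleton] at h1
    have hwe : w ⟨0, hr⟩ e ≠ 0 := fun h => h0 (funext fun x => by rw [hex x, h]; rfl)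
    funext x
    rw [hex x]
    exact (mul_eq_zero.1 h1).resolve_right hwe

theorem indep_restrict {W : Submodule K (E → K)} {F S : Finset E}
    (hproj : ∀ v ∈ W, proj F v ∈ W) (hS : S ⊆ F) :
    Indep (W ⊓ suppOn F) S ↔ Indep W S := by
  rw [indep_iff, indep_iff]
  constructor
  · intro h u hu hs
    exact h u (fun v hv => hu v hv.1) hs
  · intro h u hu hs
    refine h u (fun v hv => ?_) hs
    have h1 := hu (proj F v) ⟨hproj v hv, proj_mem_suppOn _ _⟩
    rw [← proj_dot] at h1
    have : proj F u = u := by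
      funext e
      by_cases he : e ∈ F
      · simp [proj, he]
      · simp [proj, he, hs e (fun h => he (hS h))]
    rwa [this] at h1

theorem circuit_restrict {W : Submodule K (E → K)} {F C : Finset E}
    (hproj : ∀ v ∈ W, proj F v ∈ W) (hS : C ⊆ F) (hC : IsCircuit W C) :
    IsCircuit (W ⊓ suppOn F) C :=
  ⟨fun h => hC.1 ((indep_restrict hproj hS).1 h),
    fun D hD => (indep_restrict hproj (hD.1.trans hS)).2 (hC.2 D hD)⟩

/-- **Theorem (Connectedness and irreducibility).**
Let `W ⊆ K^E` realize a matroid of rank at least `1`.  Then `M_W` is connected if and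
only if `M_W` has no loops and the configuration polynomial `ψ_W` is irreducible.
In particular, if `M_W` decomposes into connected components along a partition
`E = ⊔ᵢ Eᵢ` with induced decomposition into configurations `Wᵢ = W ∩ K^{Eᵢ}`, then
`ψ_W = c² ∏ᵢ ψ_{Wᵢ}` for some `c ≠ 0` (compatible basis choices), where `ψ_{Wᵢ}`
is irreducible when `rk Mᵢ ≥ 1` and `ψ_{Wᵢ} = 1` otherwise. -/
theorem connected_iff_loopless_and_irreducible_psi
    (W : Submodule K (E → K)) {r : ℕ} (w : Fin r → E → K)
    (hw : IsBasisOf w W) (hrk : 1 ≤ r) :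
    (Connected W ↔ (∀ e : E, Indep W {e}) ∧ Irreducible (psi w)) ∧
    (∀ (n : ℕ) (Epart : Fin n → Finset E) (rr : Fin n → ℕ)
        (ww : (i : Fin n) → Fin (rr i) → E → K),
      (∀ i j, i ≠ j → Disjoint (Epart i) (Epart j)) →
      Finset.univ.biUnion Epart = Finset.univ →
      (∀ i, ConnectedOn W (Epart i)) →
      (∀ C : Finset E, IsCircuit W C → ∃ i, C ⊆ Epart i) →
      (∀ i, IsBasisOf (ww i) (W ⊓ suppOn (Epart i))) →
      ∃ c : K, c ≠ 0 ∧ psi w = MvPolynomial.C (c ^ 2) * ∏ i : Fin n, psi (ww i) ∧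
        ∀ i, (1 ≤ rr i → Irreducible (psi (ww i))) ∧ (rr i = 0 → psi (ww i) = 1)) := by
  refine ⟨⟨fun hc => ⟨loopless_of_connected hw hrk hc, ?_⟩, fun h => ⟨?_, ?_⟩⟩, ?_⟩
  · exact irreducible_psi hw hrk (F := Finset.univ)
      (fun v _ => mem_suppOn.2 fun e he => absurd (Finset.mem_univ e) he)
      (fun e _ f _ hef => hc.2 e f hef)
  · by_contra hE
    rw [not_nonempty_iff] at hE
    exact hw.1.ne_zero (⟨0, hrk⟩ : Fin r) (Subsingleton.elim _ _)
  · intro e f hef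
    exact connected_of_irreducible hw h.2 h.1 hef
  · intro n Epart rr ww hdis hcov hconn hcirc hww
    have hproj : ∀ i, ∀ v ∈ W, proj (Epart i) v ∈ W := by
      intro i v hv
      refine proj_mem (fun C hC => ?_) hv
      obtain ⟨j, hj⟩ := hcirc C hC
      by_cases hij : j = i
      · exact Or.inl (hij ▸ hj)
      · exact Or.inr ((hdis j i hij).mono_left hj)
    obtain ⟨c, hc, h⟩ := psi_factor hw Epart rr ww hdis hcov hproj hww
    refine ⟨c, hc, h, fun i => ⟨fun hr => ?_, fun hr => psi_rank_zero hr _⟩⟩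
    refine irreducible_psi (hww i) hr inf_le_right fun e he f hf hef => ?_
    obtain ⟨C, hC, hCF, h1, h2⟩ := (hconn i).2 e he f hf hef
    exact ⟨C, circuit_restrict (hproj i) hCF hC, h1, h2⟩

end Config
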